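/- A matrix A ∈ ℝ^{n×n} is stable (i.e., every eigenvalue of A has negative real part) if and only if there exist matrices J, R, Q ∈ ℝ^{n×n} with J skew-symmetric (Jᵀ = -J), R symmetric positive definite, and Q symmetric positive definite, such that A = (J - R)Q. -/

import Mathlib

open Matrix

/-- easy direction -/
theorem easy_dir (n : ℕ) (J R Q : Matrix (Fin n) (Fin n) ℝ) (hJ : Jᵀ = -J) (hR : R.PosDef)
    (hQ : Q.PosDef) : ∀ μ ∈ spectrum ℂ (((J - R) * Q).map (algebraMap ℝ ℂ)), μ.re < 0 := by
  intro μ hμ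
  rw [spectrum.mem_iff, Matrix.isUnit_iff_isUnit_det, isUnit_iff_ne_zero, not_not,
    ← Matrix.exists_mulVec_eq_zero_iff] at hμ
  obtain ⟨v, hv, h⟩ := hμ
  set A := (J - R) * Q with hA
  set a : Fin n → ℝ := fun i => (v i).re
  set b : Fin n → ℝ := fun i => (v i).im
  have h' : (A.map (algebraMap ℝ ℂ)) *ᵥ v = μ • v := by
    rw [Matrix.sub_mulVec, sub_eq_zero] at h
    rw [← h, Algebra.algebraMap_eq_smul_one, Matrix.smul_mulVec, Matrix.one_mulVec]
  have ha : A *ᵥ a = μ.re • a - μ.im • b := by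
    ext i
    have := congrArg Complex.re (congrFun h' i)
    simpa [Matrix.mulVec, dotProduct, a, b] using this
  have hb : A *ᵥ b = μ.im • a + μ.re • b := by
    ext i
    have := congrArg Complex.im (congrFun h' i)
    simp [Matrix.mulVec, dotProduct] at this
    simp [Matrix.mulVec, dotProduct, a, b, this]; ring
  have hQs : Qᵀ = Q := by simpa using hQ.isHermitian.eq
  have hsym : b ⬝ᵥ Q *ᵥ a = a ⬝ᵥ Q *ᵥ b := by
    rw [Matrix.dotProduct_mulVec, ← Matrix.mulVec_transpose, hQs, dotProduct_comm]
  have key : ∀ x : Fin n → ℝ, x ⬝ᵥ Q *ᵥ (A *ᵥ x) = - ((Q *ᵥ x) ⬝ᵥ R *ᵥ (Q *ᵥ x)) := by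
    intro x
    have hJ0 : ∀ y : Fin n → ℝ, y ⬝ᵥ J *ᵥ y = 0 := by
      intro y
      have : y ⬝ᵥ J *ᵥ y = - (y ⬝ᵥ J *ᵥ y) := by
        conv_lhs => rw [Matrix.dotProduct_mulVec, ← Matrix.mulVec_transpose, hJ, dotProduct_comm,
          Matrix.neg_mulVec, dotProduct_neg]
      linarith
    rw [Matrix.dotProduct_mulVec, ← Matrix.mulVec_transpose, hQs, hA, ← Matrix.mulVec_mulVec,
      Matrix.sub_mulVec, dotProduct_sub, hJ0, zero_sub]
  have hneg : ∀ x : Fin n → ℝ, x ≠ 0 → x ⬝ᵥ Q *ᵥ (A *ᵥ x) < 0 := by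
    intro x hx
    rw [key, neg_lt_zero]
    have hqx : Q *ᵥ x ≠ 0 := by
      intro h0
      have := hQ.dotProduct_mulVec_pos hx
      simp [h0] at this
    simpa using hR.dotProduct_mulVec_pos hqx
  have hpos : ∀ x : Fin n → ℝ, x ≠ 0 → 0 < x ⬝ᵥ Q *ᵥ x := by
    intro x hx
    simpa using hQ.dotProduct_mulVec_pos hx
  have hsum : a ⬝ᵥ Q *ᵥ (A *ᵥ a) + b ⬝ᵥ Q *ᵥ (A *ᵥ b) = μ.re * (a ⬝ᵥ Q *ᵥ a + b ⬝ᵥ Q *ᵥ b) := by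
    rw [ha, hb]
    simp only [Matrix.mulVec_sub, Matrix.mulVec_add, Matrix.mulVec_smul, dotProduct_sub,
      dotProduct_add, dotProduct_smul, smul_eq_mul, hsym]
    ring
  have hab : a ≠ 0 ∨ b ≠ 0 := by
    by_contra! hc
    apply hv
    ext i
    exact Complex.ext (congrFun hc.1 i) (congrFun hc.2 i)
  have hle : ∀ x : Fin n → ℝ, x ⬝ᵥ Q *ᵥ (A *ᵥ x) ≤ 0 := by
    intro x
    by_cases hx : x = 0
    · simp [hx]
    · exact (hneg x hx).le
  have hge : ∀ x : Fin n → ℝ, 0 ≤ x ⬝ᵥ Q *ᵥ x := by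
    intro x
    by_cases hx : x = 0
    · simp [hx]
    · exact (hpos x hx).le
  have h1 := hle a
  have h2 := hle b
  have h3 := hge a
  have h4 := hge b
  have h5 : μ.re * (a ⬝ᵥ Q *ᵥ a + b ⬝ᵥ Q *ᵥ b) < 0 := by
    rcases hab with hx | hx
    · have := hneg _ hx; linarith
    · have := hneg _ hx; linarith
  by_contra! hc
  have := mul_nonneg hc (add_nonneg h3 h4)
  linarith

theorem exists_stein (n : ℕ) (C : Matrix (Fin n) (Fin n) ℝ) (m : ℕ) :
    ∃ Q : Matrix (Fin n) (Fin n) ℝ, Q.PosDef ∧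
      Q - Cᵀ * Q * C = 1 - (C ^ (m + 1))ᵀ * C ^ (m + 1) := by
  induction m with
  | zero => exact ⟨1, Matrix.PosDef.one, by simp⟩
  | succ m ih =>
    obtain ⟨Q, hQ, h⟩ := ih
    refine ⟨Q + (C ^ (m + 1))ᵀ * C ^ (m + 1), hQ.add_posSemidef ?_, ?_⟩
    · simpa using Matrix.posSemidef_conjTranspose_mul_self (C ^ (m + 1))
    · have h2 : Cᵀ * ((C ^ (m + 1))ᵀ * C ^ (m + 1)) * C =
          (C ^ (m + 1 + 1))ᵀ * C ^ (m + 1 + 1) := by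
        rw [pow_succ C (m + 1), Matrix.transpose_mul]
        simp only [Matrix.mul_assoc]
      rw [Matrix.mul_add, Matrix.add_mul, h2,
        show Q + (C ^ (m + 1))ᵀ * C ^ (m + 1) - (Cᵀ * Q * C + (C ^ (m + 1 + 1))ᵀ * C ^ (m + 1 + 1))
          = (Q - Cᵀ * Q * C) + (C ^ (m + 1))ᵀ * C ^ (m + 1)
            - (C ^ (m + 1 + 1))ᵀ * C ^ (m + 1 + 1) by abel, h]
      abel

open scoped Matrix.Norms.L2Operator in
theorem exists_pow_small (n : ℕ) (C : Matrix (Fin n) (Fin n) ℂ)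
    (h : ∀ μ ∈ spectrum ℂ C, ‖μ‖ < 1) : ∃ m : ℕ, ‖C ^ (m + 1)‖ < 1 := by
  rcases subsingleton_or_nontrivial (Matrix (Fin n) (Fin n) ℂ) with hs | hs
  · refine ⟨0, ?_⟩
    rw [Subsingleton.elim (C ^ (0 + 1)) 0, norm_zero]
    exact one_pos
  · have h1 : spectralRadius ℂ C < ((1 : NNReal) : ENNReal) :=
      spectrum.spectralRadius_lt_of_forall_lt C (fun z hz => by
        have := h z hz
        exact_mod_cast this)
    have h2 := (spectrum.pow_nnnorm_pow_one_div_tendsto_nhds_spectralRadius C).eventually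
      (gt_mem_nhds h1)
    obtain ⟨k, hk, hk1⟩ := (h2.and (Filter.eventually_ge_atTop 1)).exists
    refine ⟨k - 1, ?_⟩
    rw [Nat.sub_add_cancel hk1]
    by_contra! hc
    have h3 : (1 : ENNReal) ≤ (‖C ^ k‖₊ : ENNReal) := by
      exact_mod_cast hc
    have h4 : (1 : ENNReal) ≤ (‖C ^ k‖₊ : ENNReal) ^ (1 / (k : ℝ)) :=
      ENNReal.one_le_rpow h3 (by positivity)
    exact absurd hk (not_lt.mpr (by simpa using h4))

open scoped Matrix.Norms.L2Operator in
theorem posDef_one_sub (n : ℕ) (M : Matrix (Fin n) (Fin n) ℝ)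
    (h : ‖M.map (algebraMap ℝ ℂ)‖ < 1) : (1 - Mᵀ * M).PosDef := by
  refine Matrix.PosDef.of_dotProduct_mulVec_pos ?_ ?_
  · simp [Matrix.IsHermitian]
  · intro x hx
    have h1 := Matrix.l2_opNorm_mulVec (M.map (algebraMap ℝ ℂ))
      (WithLp.toLp 2 (fun i => (x i : ℂ)))
    have hx2 : ‖(WithLp.toLp 2 (fun i => (x i : ℂ)) : EuclideanSpace ℂ (Fin n))‖ ^ 2 = x ⬝ᵥ x := by
      rw [EuclideanSpace.norm_sq_eq]
      simp [dotProduct, sq]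
    have hMx : (M.map (algebraMap ℝ ℂ)) *ᵥ (fun i => (x i : ℂ)) = fun i => (((M *ᵥ x) i : ℝ) : ℂ) := by
      ext i
      simp [Matrix.mulVec, dotProduct]
    have hMx2 : ‖(EuclideanSpace.equiv (Fin n) ℂ).symm ((M.map (algebraMap ℝ ℂ)) *ᵥ
        (fun i => (x i : ℂ)))‖ ^ 2 = (M *ᵥ x) ⬝ᵥ (M *ᵥ x) := by
      rw [hMx, EuclideanSpace.norm_sq_eq]
      simp [dotProduct, sq]
    have hxpos : 0 < x ⬝ᵥ x := by
      have := (Matrix.PosDef.one (n := Fin n) (R := ℝ)).dotProduct_mulVec_pos hx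
      simpa using this
    have e : star x ⬝ᵥ (1 - Mᵀ * M) *ᵥ x = x ⬝ᵥ x - (M *ᵥ x) ⬝ᵥ (M *ᵥ x) := by
      rw [Matrix.sub_mulVec, dotProduct_sub, Matrix.one_mulVec, ← Matrix.mulVec_mulVec,
        Matrix.dotProduct_mulVec _ Mᵀ, Matrix.vecMul_transpose]
      simp
    rw [e, ← hx2, ← hMx2, sub_pos]
    rw [← hx2] at hxpos
    have hxn : 0 < ‖(WithLp.toLp 2 (fun i => (x i : ℂ)) : EuclideanSpace ℂ (Fin n))‖ := by
      by_contra! hc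
      have := le_antisymm hc (norm_nonneg _)
      rw [this] at hxpos
      simp at hxpos
    refine pow_lt_pow_left₀ (lt_of_le_of_lt h1 ?_) (norm_nonneg _) two_ne_zero
    exact mul_lt_of_lt_one_left hxn h

theorem cayley_spectrum (n : ℕ) (A C : Matrix (Fin n) (Fin n) ℂ)
    (hC : C * (1 - A) = 1 + A) (h : ∀ μ ∈ spectrum ℂ A, μ.re < 0) :
    ∀ μ ∈ spectrum ℂ C, ‖μ‖ < 1 := by
  intro μ hμ
  by_contra! hc
  rw [spectrum.mem_iff] at hμ
  apply hμ
  have e : (algebraMap ℂ (Matrix (Fin n) (Fin n) ℂ) μ - C) * (1 - A)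
      = (μ - 1) • (1 : Matrix (Fin n) (Fin n) ℂ) - (μ + 1) • A := by
    rw [sub_mul, hC, Algebra.algebraMap_eq_smul_one, smul_mul_assoc, one_mul]
    module
  have hu : IsUnit ((μ - 1) • (1 : Matrix (Fin n) (Fin n) ℂ) - (μ + 1) • A) := by
    by_cases h1 : μ + 1 = 0
    · have : μ - 1 ≠ 0 := by
        intro h2
        have : (2 : ℂ) = 0 := by linear_combination h1 - h2
        norm_num at this
      rw [h1, zero_smul, sub_zero]
      exact isUnit_one.smul (Units.mk0 _ this)
    · have hn : (μ - 1) / (μ + 1) ∉ spectrum ℂ A := by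
        intro hm
        have := h _ hm
        have hpos : 0 < Complex.normSq (μ + 1) := Complex.normSq_pos.mpr h1
        rw [Complex.div_re, ← add_div, div_lt_iff₀ hpos, zero_mul] at this
        have h3 : 1 ≤ ‖μ‖ ^ 2 := one_le_pow₀ hc
        rw [← Complex.normSq_eq_norm_sq, Complex.normSq_apply] at h3
        simp at this
        nlinarith
      rw [spectrum.notMem_iff] at hn
      have e2 : (μ - 1) • (1 : Matrix (Fin n) (Fin n) ℂ) - (μ + 1) • A
          = (μ + 1) • (algebraMap ℂ (Matrix (Fin n) (Fin n) ℂ) ((μ - 1) / (μ + 1)) - A) := by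
        rw [Algebra.algebraMap_eq_smul_one, smul_sub, smul_smul, mul_div_cancel₀ _ h1]
      rw [e2]
      exact hn.smul (Units.mk0 _ h1)
  rw [← e, Matrix.isUnit_iff_isUnit_det, Matrix.det_mul] at hu
  rw [Matrix.isUnit_iff_isUnit_det]
  exact isUnit_of_mul_isUnit_left hu

theorem lyapunov (n : ℕ) (A : Matrix (Fin n) (Fin n) ℝ)
    (h : ∀ μ ∈ spectrum ℂ (A.map (algebraMap ℝ ℂ)), μ.re < 0) :
    ∃ Q : Matrix (Fin n) (Fin n) ℝ, Q.PosDef ∧ (-(2 : ℝ) • (Aᵀ * Q + Q * A)).PosDef := by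
  have hm : (1 - A).map (algebraMap ℝ ℂ) = 1 - A.map (algebraMap ℝ ℂ) :=
    map_sub ((algebraMap ℝ ℂ).mapMatrix) 1 A |>.trans (by simp)
  have hdet : IsUnit (1 - A).det := by
    have h1 : (1 : ℂ) ∉ spectrum ℂ (A.map (algebraMap ℝ ℂ)) := by
      intro h1
      have := h _ h1
      norm_num at this
    rw [spectrum.notMem_iff, map_one, Matrix.isUnit_iff_isUnit_det, ← hm] at h1
    rw [isUnit_iff_ne_zero] at h1 ⊢
    intro h0
    apply h1
    have := (RingHom.map_det (algebraMap ℝ ℂ) (1 - A)).symm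
    rw [RingHom.mapMatrix_apply] at this
    rw [this, h0, map_zero]
  set C := (1 + A) * (1 - A)⁻¹ with hCdef
  have hC : C * (1 - A) = 1 + A := by
    rw [hCdef, Matrix.mul_assoc, Matrix.nonsing_inv_mul _ hdet, Matrix.mul_one]
  clear_value C
  have hC' : C.map (algebraMap ℝ ℂ) * (1 - A.map (algebraMap ℝ ℂ)) = 1 + A.map (algebraMap ℝ ℂ) := by
    have := congrArg ((algebraMap ℝ ℂ).mapMatrix) hC
    simpa only [map_mul, map_sub, map_add, map_one, RingHom.mapMatrix_apply] using this
  obtain ⟨m, hsm⟩ := exists_pow_small n _ (cayley_spectrum n _ _ hC' h)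
  have hpow : (C.map (algebraMap ℝ ℂ)) ^ (m + 1) = (C ^ (m + 1)).map (algebraMap ℝ ℂ) :=
    (map_pow ((algebraMap ℝ ℂ).mapMatrix) C (m + 1)).symm
  rw [hpow] at hsm
  have hP := posDef_one_sub n _ hsm
  obtain ⟨Q, hQ, hst⟩ := exists_stein n C m
  rw [← hst] at hP
  refine ⟨Q, hQ, ?_⟩
  have hinj : Function.Injective (1 - A).mulVec :=
    Matrix.mulVec_injective_iff_isUnit.mpr ((Matrix.isUnit_iff_isUnit_det _).mpr hdet)
  have h5 := hP.conjTranspose_mul_mul_same hinj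
  have e : (1 - A)ᴴ * (Q - Cᵀ * Q * C) * (1 - A) = -(2 : ℝ) • (Aᵀ * Q + Q * A) := by
    have e1 : (1 - A)ᴴ * (Q - Cᵀ * Q * C) * (1 - A)
        = (1 - A)ᵀ * Q * (1 - A) - (C * (1 - A))ᵀ * Q * (C * (1 - A)) := by
      rw [Matrix.transpose_mul, Matrix.conjTranspose_eq_transpose_of_trivial]
      rw [Matrix.mul_sub _ Q, Matrix.sub_mul]
      simp only [Matrix.mul_assoc]
    rw [e1, hC, Matrix.transpose_sub, Matrix.transpose_add, Matrix.transpose_one, neg_smul, two_smul]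
    noncomm_ring
  rwa [e] at h5

theorem stmt0 (n : ℕ) (A : Matrix (Fin n) (Fin n) ℝ) :
    (∀ μ ∈ spectrum ℂ (A.map (algebraMap ℝ ℂ)), μ.re < 0) ↔
    ∃ J R Q : Matrix (Fin n) (Fin n) ℝ,
      Jᵀ = -J ∧ R.PosDef ∧ Q.PosDef ∧ A = (J - R) * Q := by
  constructor
  · intro h
    obtain ⟨Q, hQ, hS⟩ := lyapunov n A h
    have hQs : Qᵀ = Q := by simpa using hQ.isHermitian.eq
    have hQu : IsUnit Q.det := (Matrix.isUnit_iff_isUnit_det _).mp hQ.isUnit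
    have hQi : (Q⁻¹)ᵀ = Q⁻¹ := by rw [Matrix.transpose_nonsing_inv, hQs]
    have hinj : Function.Injective (Q⁻¹).mulVec :=
      Matrix.mulVec_injective_iff_isUnit.mpr hQ.inv.isUnit
    have h5 := (hS.conjTranspose_mul_mul_same hinj).smul (show (0 : ℝ) < 1 / 4 by norm_num)
    refine ⟨(1 / 2 : ℝ) • (A * Q⁻¹ - (A * Q⁻¹)ᵀ), -(1 / 2 : ℝ) • (A * Q⁻¹ + (A * Q⁻¹)ᵀ), Q,
      ?_, ?_, hQ, ?_⟩
    · rw [Matrix.transpose_smul, Matrix.transpose_sub, Matrix.transpose_transpose]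
      module
    · convert h5 using 1
      rw [Matrix.conjTranspose_eq_transpose_of_trivial, hQi, Matrix.mul_smul, Matrix.smul_mul,
        Matrix.mul_add, Matrix.add_mul, Matrix.transpose_mul, hQi]
      rw [Matrix.mul_assoc Q⁻¹ (Aᵀ * Q), Matrix.mul_assoc Aᵀ, Matrix.mul_nonsing_inv _ hQu,
        Matrix.mul_one, ← Matrix.mul_assoc Q⁻¹ Q, Matrix.nonsing_inv_mul _ hQu, Matrix.one_mul]
      module
    · have e : (1 / 2 : ℝ) • (A * Q⁻¹ - (A * Q⁻¹)ᵀ) - -(1 / 2 : ℝ) • (A * Q⁻¹ + (A * Q⁻¹)ᵀ)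
          = A * Q⁻¹ := by module
      rw [e, Matrix.mul_assoc, Matrix.nonsing_inv_mul _ hQu, Matrix.mul_one]
  · rintro ⟨J, R, Q, hJ, hR, hQ, rfl⟩
    exact easy_dir n J R Q hJ hR hQ
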